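/- There exist forty-nine 6-element subsets T₁, …, T₄₉ of ℤ/17ℤ, pairwise inequivalent mod 17, such that every 6-element subset of ℤ/17ℤ containing 0, 1, and 2 is equivalent mod 17 to exactly one of T₁, …, T₄₉. (That is, the 364 six-element subsets of ℤ/17ℤ containing {0, 1, 2} fall into exactly 49 equivalence classes.) -/

import Mathlib

/-- Two finite subsets of `ℤ/mℤ` are equivalent mod `m` if a coloring automorphism
`x ↦ λx + μ` (with `λ` a unit) maps one onto the other. -/
def EquivColorSets (m : ℕ) (S₁ S₂ : Finset (ZMod m)) : Prop :=
  ∃ (l : (ZMod m)ˣ) (μ : ZMod m), S₁.image (fun x => (l : ZMod m) * x + μ) = S₂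

namespace EquivColorSets

theorem symm {m : ℕ} {S₁ S₂ : Finset (ZMod m)} (h : EquivColorSets m S₁ S₂) :
    EquivColorSets m S₂ S₁ := by
  obtain ⟨l, μ, rfl⟩ := h
  refine ⟨l⁻¹, -((l⁻¹ : (ZMod m)ˣ) * μ), ?_⟩
  rw [Finset.image_image]
  refine (Finset.image_congr fun x _ => ?_).trans Finset.image_id
  simp [mul_add]

theorem trans {m : ℕ} {S₁ S₂ S₃ : Finset (ZMod m)} (h₁ : EquivColorSets m S₁ S₂)
    (h₂ : EquivColorSets m S₂ S₃) : EquivColorSets m S₁ S₃ := by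
  obtain ⟨l, μ, rfl⟩ := h₁
  obtain ⟨l', μ', rfl⟩ := h₂
  refine ⟨l' * l, l' * μ + μ', ?_⟩
  rw [Finset.image_image]
  congr 1
  funext x
  simp only [Function.comp_apply, Units.val_mul]
  ring

end EquivColorSets

/-- The binary code of a set of residues; comparing codes is the colexicographic order. -/
def colexCode {m : ℕ} (S : Finset (ZMod m)) : ℕ := ∑ x ∈ S, 2 ^ x.val

theorem colexCode_injective {m : ℕ} [NeZero m] :
    Function.Injective (colexCode : Finset (ZMod m) → ℕ) := by
  intro S T h
  have key : ∀ U : Finset (ZMod m), colexCode U = ∑ n ∈ U.image ZMod.val, 2 ^ n := fun U =>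
    (Finset.sum_image (ZMod.val_injective m).injOn).symm
  rw [key, key] at h
  exact Finset.image_injective (ZMod.val_injective m) (Finset.geomSum_injective le_rfl h)

/-- The contribution `2 ^ ((l * x + μ) % 17)` of the image of `x` to the code of an affine image,
written with the `Nat` operations that the kernel evaluates natively. -/
def affineBit (l μ x : ℕ) : ℕ := Nat.pow 2 (Nat.mod (Nat.add (Nat.mul l x) μ) 17)

theorem colexCode_image (l : (ZMod 17)ˣ) (μ : ZMod 17) (S : Finset (ZMod 17)) :
    colexCode (S.image fun x => (l : ZMod 17) * x + μ) =
      ∑ n ∈ S.image ZMod.val, affineBit (l : ZMod 17).val μ.val n := by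
  rw [colexCode, Finset.sum_image, Finset.sum_image (ZMod.val_injective 17).injOn]
  · refine Finset.sum_congr rfl fun x _ => ?_
    rw [ZMod.val_add, ZMod.val_mul, Nat.mod_add_mod]
    rfl
  · intro x _ y _ h
    simpa using h

/-- The codes of the colexicographically least members of the equivalence classes mod 17 of
6-element sets that contain a translate of a set `{0, d, 2 * d}` with `d ≠ 0`. -/
def leastCodes : List ℕ :=
   [63, 95, 111, 119, 159, 175, 183, 187, 189, 207, 215, 219, 231, 287, 303, 311, 315, 317,
    335, 343, 347, 349, 359, 363, 371, 399, 407, 423, 427, 559, 567, 573, 591, 599, 605, 619,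
    629, 633, 663, 669, 679, 691, 807, 1071, 1083, 1085, 1103, 1175, 1253]

theorem length_leastCodes : leastCodes.length = 49 := rfl

theorem nodup_leastCodes : leastCodes.Nodup := by decide +kernel

/-- The exponents of the binary digits of `c` below `2 ^ 17` that are equal to one. -/
def bits (c : ℕ) : List ℕ := (List.range 17).filter (Nat.testBit c)

theorem nodup_bits (c : ℕ) : (bits c).Nodup := List.nodup_range.filter _

/-- The set of residues mod 17 with code `c`. -/
def ofCode (c : ℕ) : Finset (ZMod 17) := Finset.univ.filter fun x => c.testBit x.val

theorem image_val_ofCode (c : ℕ) : (ofCode c).image ZMod.val = (bits c).toFinset := by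
  ext n
  simp only [ofCode, bits, Finset.mem_image, Finset.mem_filter, Finset.mem_univ, true_and,
    List.mem_toFinset, List.mem_filter, List.mem_range]
  constructor
  · rintro ⟨x, hx, rfl⟩
    exact ⟨x.val_lt, hx⟩
  · rintro ⟨hn, hc⟩
    exact ⟨n, by rwa [ZMod.val_natCast_of_lt hn], ZMod.val_natCast_of_lt hn⟩

theorem card_ofCode {c : ℕ} (hc : c ∈ leastCodes) : (ofCode c).card = 6 := by
  rw [← Finset.card_image_of_injective _ (ZMod.val_injective 17), image_val_ofCode,
    List.toFinset_card_of_nodup (nodup_bits c)]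
  have key : ∀ c ∈ leastCodes, (bits c).length = 6 := by decide +kernel
  exact key c hc

theorem colexCode_ofCode {c : ℕ} (hc : c ∈ leastCodes) : colexCode (ofCode c) = c := by
  rw [colexCode, ← Finset.sum_image (f := fun n => 2 ^ n) (ZMod.val_injective 17).injOn,
    image_val_ofCode, List.sum_toFinset _ (nodup_bits c)]
  have key : ∀ c ∈ leastCodes, ((bits c).map fun n => 2 ^ n).sum = c := by decide +kernel
  exact key c hc

theorem le_sum_affineBit :
    (leastCodes.all fun c => (List.range 17).all fun l => (List.range 17).all fun μ =>
      Nat.beq l 0 || Nat.ble c ((bits c).map (affineBit l μ)).sum) = true := by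
  decide +kernel

theorem le_colexCode_of_equiv {c : ℕ} (hc : c ∈ leastCodes) {S : Finset (ZMod 17)}
    (h : EquivColorSets 17 (ofCode c) S) : c ≤ colexCode S := by
  obtain ⟨l, μ, rfl⟩ := h
  have : Fact (1 < 17) := ⟨by norm_num⟩
  rw [colexCode_image, image_val_ofCode, List.sum_toFinset _ (nodup_bits c)]
  have key := le_sum_affineBit
  simp only [List.all_eq_true, List.mem_range, Bool.or_eq_true] at key
  rcases key c hc _ (ZMod.val_lt (l : ZMod 17)) _ (ZMod.val_lt μ) with h | h
  · exact absurd ((ZMod.val_eq_zero _).1 (Nat.eq_of_beq_eq_true h)) l.ne_zero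
  · exact Nat.le_of_ble_eq_true h

theorem eq_of_equiv_ofCode {c d : ℕ} (hc : c ∈ leastCodes) (hd : d ∈ leastCodes)
    (h : EquivColorSets 17 (ofCode c) (ofCode d)) : c = d := by
  have h₁ := le_colexCode_of_equiv hc h
  have h₂ := le_colexCode_of_equiv hd h.symm
  rw [colexCode_ofCode hd] at h₁
  rw [colexCode_ofCode hc] at h₂
  exact le_antisymm h₁ h₂

/-- The code of the image of `{a, b, c}`, for distinct residues, under `x ↦ l * x + μ`. -/
def tripleCode (l μ a b c : ℕ) : ℕ :=
  Nat.add (affineBit l μ a) (Nat.add (affineBit l μ b) (affineBit l μ c))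

theorem sum_affineBit_triple (l μ : ℕ) {a b c : ℕ} (hab : a < b) (hbc : b < c) :
    ∑ n ∈ ({a, b, c} : Finset ℕ), affineBit l μ n = tripleCode l μ a b c := by
  rw [Finset.sum_insert (by simp; lia), Finset.sum_pair hbc.ne]
  rfl

/-- Whether some affine image of `{0, 1, 2, a, b, c}` has its code in `leastCodes`. The comparison
with the largest of these codes saves most of the membership tests. -/
def reachesLeastCode (a b c : ℕ) : Bool :=
  (List.range 17).any fun μ => (List.range' 1 16).any fun l =>
    let w := Nat.add (tripleCode l μ 0 1 2) (tripleCode l μ a b c)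
    Nat.ble w 1253 && leastCodes.any (Nat.beq w)

theorem reachesLeastCode_eq_true :
    ∀ c < 17, ∀ b < c, ∀ a < b, 3 ≤ a → reachesLeastCode a b c = true := by
  decide +kernel

theorem exists_triple_of_card_eq_three {M : Finset ℕ} (hM : M.card = 3) :
    ∃ a b c, a < b ∧ b < c ∧ M = {a, b, c} := by
  let e := M.orderEmbOfFin hM
  refine ⟨e 0, e 1, e 2, e.strictMono (by decide), e.strictMono (by decide), ?_⟩
  rw [← M.image_orderEmbOfFin_univ hM, show (Finset.univ : Finset (Fin 3)) = {0, 1, 2} from rfl]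
  simp only [Finset.image_insert, Finset.image_singleton, e]

theorem exists_equiv_ofCode {S : Finset (ZMod 17)} (hS : S.card = 6)
    (h012 : ({0, 1, 2} : Finset (ZMod 17)) ⊆ S) :
    ∃ d ∈ leastCodes, EquivColorSets 17 S (ofCode d) := by
  have hsub : ({0, 1, 2} : Finset ℕ) ⊆ S.image ZMod.val :=
    (Finset.image_subset_image (f := ZMod.val) h012 :)
  have hcard : (S.image ZMod.val \ {0, 1, 2}).card = 3 := by
    rw [Finset.card_sdiff_of_subset hsub,
      Finset.card_image_of_injective _ (ZMod.val_injective 17), hS]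
    rfl
  obtain ⟨a, b, c, hab, hbc, hM⟩ := exists_triple_of_card_eq_three hcard
  have ha : a ∈ S.image ZMod.val \ {0, 1, 2} := by simp [hM]
  have hc : c ∈ S.image ZMod.val \ {0, 1, 2} := by simp [hM]
  have ha3 : 3 ≤ a := by
    have := (Finset.mem_sdiff.1 ha).2
    simp only [Finset.mem_insert, Finset.mem_singleton] at this
    lia
  have hc17 : c < 17 := by
    obtain ⟨x, -, rfl⟩ := Finset.mem_image.1 (Finset.mem_sdiff.1 hc).1
    exact x.val_lt
  have key := reachesLeastCode_eq_true c hc17 b hbc a hab ha3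
  simp only [reachesLeastCode, List.any_eq_true, Bool.and_eq_true, List.mem_range,
    List.mem_range'_1] at key
  obtain ⟨μ, hμ, l, ⟨hl, hl'⟩, -, d, hd, hw⟩ := key
  have : Fact (Nat.Prime 17) := ⟨by norm_num⟩
  have hlval : (l : ZMod 17).val = l := ZMod.val_natCast_of_lt (by lia)
  have hl0 : (l : ZMod 17) ≠ 0 := fun h => by
    rw [h, ZMod.val_zero] at hlval
    lia
  refine ⟨d, hd, Units.mk0 _ hl0, μ, colexCode_injective ?_⟩
  rw [colexCode_image, colexCode_ofCode hd, Units.val_mk0, hlval, ZMod.val_natCast_of_lt hμ,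
    ← Finset.sum_sdiff hsub, hM, sum_affineBit_triple l μ hab hbc,
    sum_affineBit_triple l μ zero_lt_one one_lt_two, add_comm]
  exact Nat.eq_of_beq_eq_true hw

/-- The 6-element subsets of `ℤ/17ℤ` containing `{0, 1, 2}` fall into exactly 49
equivalence classes mod 17. -/
theorem stmt_19 :
    ∃ T : Fin 49 → Finset (ZMod 17),
      (∀ i, (T i).card = 6) ∧
      (∀ i j, i ≠ j → ¬ EquivColorSets 17 (T i) (T j)) ∧
      (∀ S : Finset (ZMod 17), S.card = 6 → ({0, 1, 2} : Finset (ZMod 17)) ⊆ S →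
        ∃! i : Fin 49, EquivColorSets 17 S (T i)) := by
  have hmem : ∀ i : Fin 49, leastCodes.get i ∈ leastCodes := fun i => List.get_mem _ _
  have hinj : ∀ i j : Fin 49,
      EquivColorSets 17 (ofCode (leastCodes.get i)) (ofCode (leastCodes.get j)) → i = j :=
    fun i j h => nodup_leastCodes.injective_get (eq_of_equiv_ofCode (hmem i) (hmem j) h)
  refine ⟨fun i => ofCode (leastCodes.get i), fun i => card_ofCode (hmem i),
    fun i j hij h => hij (hinj i j h), fun S hS h012 => ?_⟩
  obtain ⟨d, hd, h⟩ := exists_equiv_ofCode hS h012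
  obtain ⟨i, rfl⟩ := List.get_of_mem hd
  exact ⟨i, h, fun j hj => hinj j i (hj.symm.trans h)⟩
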